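/- arXiv:2402.11692 — 10 statements merged into one kernel-verified Lean document; each statement's English description precedes it below -/
import Mathlib

section
/- Let a ∈ (0, 1/2). For reals x > 0, y > 0 and z ≥ 0, the equations λ_a(x; y, z) = 0 and λ_a(y; x, z) = 0 hold simultaneously if and only if either (x = y and z = 0) or (z > 0 and x = y = az). Hence each pair of cones Λ_i, Λ_j intersects along exactly two straight lines: x_i = x_j = u, x_k = 0 and x_i = x_j = av, x_k = v (u, v > 0). -/
/-- `λ_a(x; y, z) = yz + a(x² − y² − z²)`. -/
def lam (a x y z : ℝ) : ℝ := y * z + a * (x ^ 2 - y ^ 2 - z ^ 2)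

/-- For `a ∈ (0, 1/2)`, `x, y > 0`, `z ≥ 0`: the equations `λ_a(x; y, z) = 0` and
`λ_a(y; x, z) = 0` hold simultaneously iff either `x = y` and `z = 0`, or `z > 0` and
`x = y = a·z`.  Hence each pair of the cones `Λ_i, Λ_j` intersects exactly along the two
straight lines `x_i = x_j = u, x_k = 0` and `x_i = x_j = a·v, x_k = v` (`u, v > 0`). -/
theorem lambda_cones_intersection (a : ℝ) (ha₀ : 0 < a) (ha : a < 1 / 2) :
    ∀ x y z : ℝ, 0 < x → 0 < y → 0 ≤ z →
      ((lam a x y z = 0 ∧ lam a y x z = 0) ↔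
        (x = y ∧ z = 0) ∨ (0 < z ∧ x = a * z ∧ y = a * z)) := by
  intro x y z hx hy hz
  unfold lam
  constructor
  · rintro ⟨h₁, h₂⟩
    have hsum : z * (x + y - 2 * a * z) = 0 := by linear_combination h₁ + h₂
    have hdiff : (x - y) * (2 * a * (x + y) - z) = 0 := by linear_combination h₁ - h₂
    rcases hz.eq_or_lt with rfl | hz
    · have hne : 2 * a * (x + y) - 0 ≠ 0 := by rw [sub_zero]; positivity
      exact .inl ⟨sub_eq_zero.mp ((mul_eq_zero.mp hdiff).resolve_right hne), rfl⟩
    · have hxy : x + y - 2 * a * z = 0 := (mul_eq_zero.mp hsum).resolve_left hz.ne'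
      have hneg : 2 * a * (x + y) - z < 0 := by
        have hfactor : 2 * a * (x + y) - z = -((1 - 2 * a) * (1 + 2 * a) * z) := by
          linear_combination 2 * a * hxy
        have hpos : 0 < 1 - 2 * a := by linarith
        rw [hfactor, neg_lt_zero]
        positivity
      have heq : x - y = 0 := (mul_eq_zero.mp hdiff).resolve_right hneg.ne
      exact .inr ⟨hz, by linarith, by linarith⟩
  · rintro (⟨rfl, rfl⟩ | ⟨-, rfl, rfl⟩) <;> constructor <;> ring
end

section
/- For every t > 0 with t ≠ 1, the quantity (−t − 1 + 2√(t² − t + 1))/(t(t − 1)²) is positive, so α(t) := ((−t − 1 + 2√(t² − t + 1))/(t(t − 1)²))^{1/3} > 0 is well defined; and the point (x₁, x₂, x₃) := (t·α(t), α(t), 1/(t·α(t)²)) satisfies x₁x₂x₃ = 1 and γ(x₃; x₁, x₂) = 0, i.e. it lies on the boundary curve s₃ = Σ ∩ Γ₃. -/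
/-- `γ(x; y, z) = (y − z)² + 2x(y + z) − 3x²`. -/
def gamma (x y z : ℝ) : ℝ := (y - z) ^ 2 + 2 * x * (y + z) - 3 * x ^ 2

/-- For `t > 0`, `t ≠ 1`, the radicand `(−t − 1 + 2√(t² − t + 1))/(t(t − 1)²)` is
positive, so `α(t)` (its cube root) is well defined and positive, and the point
`(t·α, α, 1/(t·α²))` lies on `s₃ = Σ ∩ Γ₃`, i.e. it satisfies `x₁x₂x₃ = 1` and
`γ(x₃; x₁, x₂) = 0`. -/
theorem s3_parametrization (t : ℝ) (ht : 0 < t) (ht1 : t ≠ 1) :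
    0 < (-t - 1 + 2 * Real.sqrt (t ^ 2 - t + 1)) / (t * (t - 1) ^ 2) ∧
    ∀ α : ℝ, α = ((-t - 1 + 2 * Real.sqrt (t ^ 2 - t + 1)) /
        (t * (t - 1) ^ 2)) ^ ((1 : ℝ) / 3) →
      0 < α ∧
      (t * α) * α * (1 / (t * α ^ 2)) = 1 ∧
      gamma (1 / (t * α ^ 2)) (t * α) α = 0 := by
  have hsub : 0 < (t - 1) ^ 2 := by
    have := sub_ne_zero.mpr ht1
    positivity
  have hden : 0 < t * (t - 1) ^ 2 := mul_pos ht hsub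
  have hsq : Real.sqrt (t ^ 2 - t + 1) ^ 2 = t ^ 2 - t + 1 :=
    Real.sq_sqrt (by nlinarith)
  have hpos : 0 < (-t - 1 + 2 * Real.sqrt (t ^ 2 - t + 1)) / (t * (t - 1) ^ 2) := by
    have : (t + 1) / 2 < Real.sqrt (t ^ 2 - t + 1) :=
      Real.lt_sqrt_of_sq_lt (by nlinarith)
    exact div_pos (by linarith) hden
  refine ⟨hpos, fun α hα => ?_⟩
  have hα_pos : 0 < α := hα ▸ Real.rpow_pos_of_pos hpos _
  have hcube : α ^ 3 = (-t - 1 + 2 * Real.sqrt (t ^ 2 - t + 1)) / (t * (t - 1) ^ 2) := by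
    rw [hα, ← Real.rpow_natCast, ← Real.rpow_mul hpos.le]
    norm_num
  rw [eq_div_iff hden.ne'] at hcube
  have hquad : t ^ 2 * (t - 1) ^ 2 * (α ^ 3) ^ 2 + 2 * t * (t + 1) * α ^ 3 - 3 = 0 := by
    refine (mul_eq_zero.mp ?_).resolve_left hsub.ne'
    linear_combination (α ^ 3 * (t * (t - 1) ^ 2) + (t + 1) +
      2 * Real.sqrt (t ^ 2 - t + 1)) * hcube + 4 * hsq
  refine ⟨hα_pos, by field_simp, ?_⟩
  have hgamma : gamma (1 / (t * α ^ 2)) (t * α) α =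
      (t ^ 2 * (t - 1) ^ 2 * (α ^ 3) ^ 2 + 2 * t * (t + 1) * α ^ 3 - 3) /
        (t ^ 2 * α ^ 4) := by
    unfold gamma
    field_simp
  rw [hgamma, hquad, zero_div]
end

section
/- Extend α to all of (0, ∞) by setting α(t) := ((−t − 1 + 2√(t² − t + 1))/(t(t − 1)²))^{1/3} for t ≠ 1 and α(1) := ∛6/2. Then for every (x₁, x₂, x₃) ∈ (0, ∞)³ with x₁x₂x₃ = 1 and γ(x₃; x₁, x₂) = 0 there exists t > 0 (namely t = x₁/x₂) such that x₁ = t·α(t), x₂ = α(t) and x₃ = 1/(t·α(t)²); i.e. the parametrization covers the whole curve s₃ = Σ ∩ Γ₃. -/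
/-- The parametrizing function `α` of the curve `s₃`, extended by continuity to `t = 1`
by `α(1) = ∛6/2`. -/
noncomputable def alpha (t : ℝ) : ℝ :=
  if t = 1 then (6 : ℝ) ^ ((1 : ℝ) / 3) / 2
  else ((-t - 1 + 2 * Real.sqrt (t ^ 2 - t + 1)) / (t * (t - 1) ^ 2)) ^ ((1 : ℝ) / 3)

/-- For `t > 0`, `α(t)` is the only positive `a` whose cube `u` solves
`t²(t − 1)²u² + 2t(t + 1)u = 3`. -/
lemma alpha_eq_of_cube_root {t a : ℝ} (ht : 0 < t) (ha : 0 < a)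
    (h : t ^ 2 * (t - 1) ^ 2 * (a ^ 3) ^ 2 + 2 * t * (t + 1) * a ^ 3 = 3) :
    alpha t = a := by
  have cube_rpow : ∀ b : ℝ, 0 ≤ b → (b ^ 3) ^ ((1 : ℝ) / 3) = b := fun b hb => by
    rw [one_div]
    exact_mod_cast Real.pow_rpow_inv_natCast hb (n := 3) (by norm_num)
  unfold alpha
  split_ifs with h1
  · subst h1
    rw [show (6 : ℝ) = (2 * a) ^ 3 by linarith, cube_rpow _ (by positivity)]
    ring
  · have hsqrt : Real.sqrt (t ^ 2 - t + 1) = (t * (t - 1) ^ 2 * a ^ 3 + t + 1) / 2 := by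
      rw [Real.sqrt_eq_iff_mul_self_eq (by nlinarith) (by positivity)]
      linear_combination -(t - 1) ^ 2 / 4 * h
    have ht1 : t - 1 ≠ 0 := sub_ne_zero.mpr h1
    have hquot : (-t - 1 + 2 * Real.sqrt (t ^ 2 - t + 1)) / (t * (t - 1) ^ 2) = a ^ 3 := by
      rw [hsqrt]
      field_simp
      ring
    rw [hquot, cube_rpow _ ha.le]

/-- Every point of `s₃ = Σ ∩ Γ₃` (i.e. every `(x₁, x₂, x₃) ∈ (0, ∞)³` with
`x₁x₂x₃ = 1` and `γ(x₃; x₁, x₂) = 0`) is of the form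
`(t·α(t), α(t), 1/(t·α(t)²))` with `t = x₁/x₂ > 0`:
the parametrization covers the whole curve. -/
theorem s3_parametrization_surjective
    (x₁ x₂ x₃ : ℝ) (h₁ : 0 < x₁) (h₂ : 0 < x₂) (h₃ : 0 < x₃)
    (hV : x₁ * x₂ * x₃ = 1) (hγ : gamma x₃ x₁ x₂ = 0) :
    ∃ t : ℝ, 0 < t ∧ t = x₁ / x₂ ∧
      x₁ = t * alpha t ∧ x₂ = alpha t ∧ x₃ = 1 / (t * (alpha t) ^ 2) := by
  have hα : alpha (x₁ / x₂) = x₂ := by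
    refine alpha_eq_of_cube_root (div_pos h₁ h₂) h₂ ?_
    unfold gamma at hγ
    have h_expand : (x₁ / x₂) ^ 2 * (x₁ / x₂ - 1) ^ 2 * (x₂ ^ 3) ^ 2
        + 2 * (x₁ / x₂) * (x₁ / x₂ + 1) * x₂ ^ 3
        = (x₁ * x₂) ^ 2 * (x₁ - x₂) ^ 2 + 2 * (x₁ * x₂) * (x₁ + x₂) := by
      field_simp
    rw [h_expand]
    linear_combination (x₁ * x₂) ^ 2 * hγ
      + (3 * (x₁ * x₂ * x₃ + 1) - 2 * (x₁ * x₂) * (x₁ + x₂)) * hV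
  refine ⟨x₁ / x₂, div_pos h₁ h₂, rfl, ?_, hα.symm, ?_⟩
  · rw [hα]
    field_simp
  · rw [hα]
    field_simp
    linear_combination hV
end

section
/- The curve s₃ := {(x₁, x₂, x₃) ∈ (0, ∞)³ : x₁x₂x₃ = 1 and γ(x₃; x₁, x₂) = 0} is a connected subset of ℝ³. -/
/-- The curve `s₃ = Σ ∩ Γ₃`, i.e.
`{(x₁, x₂, x₃) ∈ (0, ∞)³ : x₁x₂x₃ = 1, γ(x₃; x₁, x₂) = 0}`, as a subset of `ℝ³`. -/
def s3 : Set (ℝ × ℝ × ℝ) :=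
  {p | 0 < p.1 ∧ 0 < p.2.1 ∧ 0 < p.2.2 ∧ p.1 * p.2.1 * p.2.2 = 1 ∧
    gamma p.2.2 p.1 p.2.1 = 0}

/-- For `u > 0`, the unique positive root `w` of `γ(w; u, 1) = 0`. -/
noncomputable def gammaRoot (u : ℝ) : ℝ := (u + 1 + √((u + 1) ^ 2 + 3 * (u - 1) ^ 2)) / 3

theorem gammaRoot_pos {u : ℝ} (hu : 0 < u) : 0 < gammaRoot u := by
  unfold gammaRoot
  positivity

theorem continuous_gammaRoot : Continuous gammaRoot := by
  unfold gammaRoot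
  fun_prop

theorem gamma_gammaRoot (u : ℝ) : gamma (gammaRoot u) u 1 = 0 := by
  have h := Real.sq_sqrt (show 0 ≤ (u + 1) ^ 2 + 3 * (u - 1) ^ 2 by positivity)
  unfold gamma gammaRoot
  linear_combination -h / 3

theorem eq_gammaRoot {u w : ℝ} (hu : 0 < u) (hw : 0 < w) (h : gamma w u 1 = 0) :
    w = gammaRoot u := by
  have hr := gammaRoot_pos hu
  have hroot := gamma_gammaRoot u
  have hbound : 2 * (u + 1) < 3 * (w + gammaRoot u) := by
    have hsqrt : u + 1 ≤ √((u + 1) ^ 2 + 3 * (u - 1) ^ 2) :=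
      Real.le_sqrt_of_sq_le (by nlinarith [sq_nonneg (u - 1)])
    have hge : 2 * (u + 1) ≤ 3 * gammaRoot u := by
      unfold gammaRoot
      linarith
    linarith
  have hfactor : (w - gammaRoot u) * (2 * (u + 1) - 3 * (w + gammaRoot u)) = 0 := by
    unfold gamma at h hroot
    linear_combination h - hroot
  rcases mul_eq_zero.mp hfactor with h₁ | h₁ <;> linarith

theorem gamma_smul (c x y z : ℝ) : gamma (c * x) (c * y) (c * z) = c ^ 2 * gamma x y z := by
  unfold gamma
  ring

/-- The parametrization of `s₃` by the ratio `u = x₁ / x₂`. -/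
noncomputable def s3Param (u : ℝ) : ℝ × ℝ × ℝ :=
  let c := (u * gammaRoot u) ^ (-(1 / 3) : ℝ)
  (c * u, c * 1, c * gammaRoot u)

theorem continuousOn_s3Param : ContinuousOn s3Param (Set.Ioi 0) := by
  have hw := continuous_gammaRoot.continuousOn (s := Set.Ioi 0)
  have hc : ContinuousOn (fun u : ℝ => (u * gammaRoot u) ^ (-(1 / 3) : ℝ)) (Set.Ioi 0) :=
    (continuousOn_id.mul hw).rpow_const fun u hu =>
      Or.inl (mul_pos hu (gammaRoot_pos hu)).ne'
  exact (hc.mul continuousOn_id).prodMk ((hc.mul continuousOn_const).prodMk (hc.mul hw))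

theorem s3Param_mem {u : ℝ} (hu : 0 < u) : s3Param u ∈ s3 := by
  have hw := gammaRoot_pos hu
  have hprod : 0 < u * gammaRoot u := mul_pos hu hw
  have hc : 0 < (u * gammaRoot u) ^ (-(1 / 3) : ℝ) := Real.rpow_pos_of_pos hprod _
  have hcube : ((u * gammaRoot u) ^ (-(1 / 3) : ℝ)) ^ 3 * (u * gammaRoot u) = 1 := by
    rw [← Real.rpow_mul_natCast hprod.le]
    norm_num
    rw [Real.rpow_neg_one]
    field_simp
  refine ⟨mul_pos hc hu, mul_pos hc one_pos, mul_pos hc hw, ?_, ?_⟩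
  · simp only [s3Param]
    linear_combination hcube
  · simp only [s3Param]
    rw [gamma_smul, gamma_gammaRoot, mul_zero]

theorem s3Param_div {p : ℝ × ℝ × ℝ} (hp : p ∈ s3) : s3Param (p.1 / p.2.1) = p := by
  obtain ⟨x, y, z⟩ := p
  obtain ⟨hx, hy, hz, hprod, hgamma⟩ := hp
  dsimp only at hx hy hz hprod hgamma ⊢
  have hroot : z / y = gammaRoot (x / y) := by
    refine eq_gammaRoot (div_pos hx hy) (div_pos hz hy) ?_
    have h := gamma_smul y⁻¹ z x y
    rw [hgamma, mul_zero, inv_mul_cancel₀ hy.ne'] at h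
    rwa [div_eq_inv_mul, div_eq_inv_mul]
  have hc : (x / y * (z / y)) ^ (-(1 / 3) : ℝ) = y := by
    have hpow : x / y * (z / y) = y ^ (-3 : ℝ) := by
      rw [Real.rpow_neg hy.le]
      norm_cast
      field_simp
      linear_combination hprod
    rw [hpow, ← Real.rpow_mul hy.le]
    norm_num
  simp only [s3Param, ← hroot, hc]
  simp only [mul_one, mul_div_cancel₀ _ hy.ne']

theorem s3Param_image : s3Param '' Set.Ioi 0 = s3 := by
  ext p
  constructor
  · rintro ⟨u, hu, rfl⟩
    exact s3Param_mem hu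
  · intro hp
    exact ⟨p.1 / p.2.1, div_pos hp.1 hp.2.1, s3Param_div hp⟩

/-- The curve `s₃` is a connected subset of `ℝ³`. -/
theorem s3_connected : IsConnected s3 := by
  rw [← s3Param_image]
  exact isConnected_Ioi.image _ continuousOn_s3Param
end

section
/- Let x₁, x₂, x₃ > 0 with x₂ ≠ x₃. Then the gradient of V(x₁, x₂, x₃) = x₁x₂x₃, namely (x₂x₃, x₁x₃, x₁x₂), and the gradient of γ₁ = γ(x₁; x₂, x₃), namely (2(x₂ + x₃) − 6x₁, 2(x₂ − x₃) + 2x₁, 2(x₃ − x₂) + 2x₁), are linearly independent vectors in ℝ³. In particular the surfaces Σ and Γ₁ intersect transversally, so s₁ = Σ ∩ Γ₁ is a regular curve. -/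
/-- For positive `x₁, x₂, x₃` with `x₂ ≠ x₃`, the gradient `(x₂x₃, x₁x₃, x₁x₂)` of
`V = x₁x₂x₃` and the gradient
`(2(x₂ + x₃) − 6x₁, 2(x₂ − x₃) + 2x₁, 2(x₃ − x₂) + 2x₁)` of
`γ₁ = (x₂ − x₃)² + 2x₁(x₂ + x₃) − 3x₁²` are linearly independent vectors in `ℝ³`;
hence `Σ` and `Γ₁` intersect transversally and `s₁ = Σ ∩ Γ₁` is a regular curve. -/
theorem gradients_V_gamma1_linearIndependent
    (x₁ x₂ x₃ : ℝ) (h₁ : 0 < x₁) (h₂ : 0 < x₂) (h₃ : 0 < x₃) (h : x₂ ≠ x₃) :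
    LinearIndependent ℝ
      ![(![x₂ * x₃, x₁ * x₃, x₁ * x₂] : Fin 3 → ℝ),
        ![2 * (x₂ + x₃) - 6 * x₁, 2 * (x₂ - x₃) + 2 * x₁,
          2 * (x₃ - x₂) + 2 * x₁]] := by
  rw [LinearIndependent.pair_iff]
  intro s t hst
  have e₂ := congrFun hst 1
  have e₃ := congrFun hst 2
  simp at e₂ e₃
  have key : t * ((x₂ - x₃) * (x₁ + x₂ + x₃)) = 0 := by
    linear_combination (x₂ * e₂ - x₃ * e₃) / 2
  have ht : t = 0 :=
    (mul_eq_zero.mp key).resolve_right (mul_ne_zero (sub_ne_zero.mpr h) (by positivity))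
  subst ht
  have hs : s * (x₁ * x₃) = 0 := by linear_combination e₂
  exact ⟨(mul_eq_zero.mp hs).resolve_right (by positivity), rfl⟩
end

section
/- Let p > 0 and consider the point (p, p, p⁻²) on the invariant curve I₃ of the normalized Ricci flow. Then γ(p⁻²; p, p) = (4p³ − 3)/p⁴, which vanishes if and only if p = ∛6/2 (equivalently p³ = 3/4); moreover γ(p; p, p⁻²) = p⁻⁴ > 0 for all p > 0, and p⁻⁴ → 0 as p → +∞. Hence I₃ meets the curve s₃ at exactly one point (p₀, p₀, p₀⁻²) with p₀ = ∛6/2, never meets s₁ or s₂, and approaches s₁ and s₂ asymptotically at infinity. -/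
open Filter Topology

/-- Along `(p, p, p⁻²)`, the quantity `γ₃` equals `(4p³ − 3)/p⁴`. -/
lemma gamma_inv_sq_self_self {p : ℝ} (hp : 0 < p) :
    gamma (p ^ 2)⁻¹ p p = (4 * p ^ 3 - 3) / p ^ 4 := by
  unfold gamma
  field_simp
  ring

lemma gamma_inv_sq_self_self_eq_zero_iff {p : ℝ} (hp : 0 < p) :
    gamma (p ^ 2)⁻¹ p p = 0 ↔ p ^ 3 = 3 / 4 := by
  rw [gamma_inv_sq_self_self hp, div_eq_zero_iff, or_iff_left (by positivity)]
  constructor <;> intro h <;> linarith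

lemma pow_three_eq_three_quarters_iff {p : ℝ} (hp : 0 < p) :
    p ^ 3 = 3 / 4 ↔ p = (6 : ℝ) ^ ((1 : ℝ) / 3) / 2 := by
  have hcube : ((6 : ℝ) ^ ((1 : ℝ) / 3) / 2) ^ 3 = 3 / 4 := by
    rw [div_pow, ← Real.rpow_natCast, ← Real.rpow_mul (by norm_num)]
    norm_num
  rw [← hcube]
  exact pow_left_inj₀ hp.le (by positivity) (by norm_num)

/-- Along the invariant curve `I₃ = {(p, p, p⁻²) : p > 0}`:
`γ₃ = γ(p⁻²; p, p) = (4p³ − 3)/p⁴`, vanishing iff `p = ∛6/2` (equivalently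
`p³ = 3/4`); `γ₁ = γ₂ = γ(p; p, p⁻²) = p⁻⁴ > 0` never vanishes, and `p⁻⁴ → 0` as
`p → +∞`.  Hence `I₃` meets `s₃` exactly at `(p₀, p₀, p₀⁻²)` with `p₀ = ∛6/2`,
never meets `s₁` or `s₂`, and approaches them asymptotically at infinity. -/
theorem I3_meets_s3_once :
    (∀ p : ℝ, 0 < p →
      gamma (p ^ 2)⁻¹ p p = (4 * p ^ 3 - 3) / p ^ 4 ∧
      (gamma (p ^ 2)⁻¹ p p = 0 ↔ p = (6 : ℝ) ^ ((1 : ℝ) / 3) / 2) ∧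
      (gamma (p ^ 2)⁻¹ p p = 0 ↔ p ^ 3 = 3 / 4) ∧
      gamma p p (p ^ 2)⁻¹ = (p ^ 4)⁻¹ ∧
      0 < (p ^ 4)⁻¹) ∧
    Tendsto (fun p : ℝ => (p ^ 4)⁻¹) atTop (𝓝 0) := by
  refine ⟨fun p hp => ⟨gamma_inv_sq_self_self hp, ?_, gamma_inv_sq_self_self_eq_zero_iff hp,
    ?_, by positivity⟩, ?_⟩
  · rw [gamma_inv_sq_self_self_eq_zero_iff hp, pow_three_eq_three_quarters_iff hp]
  · unfold gamma
    ring
  · exact (tendsto_pow_atTop (by norm_num)).inv_tendsto_atTop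
end

section
/- Let a ∈ (0, 1/2). For every t ∈ (0, a] the radicand t⁴ − t³/a + t² is positive, so β(t) := (t⁴ − t³/a + t²)^{−1/6} > 0 is well defined; and the point (x₁, x₂, x₃) := (t·β(t), β(t), 1/(t·β(t)²)) satisfies x₁x₂x₃ = 1 and λ_a(x₃; x₁, x₂) = 0, i.e. it lies on the boundary curve r₃ = Σ ∩ Λ₃ of the set of metrics with positive Ricci curvature. -/
/-- For `a ∈ (0, 1/2)` and `t ∈ (0, a]` the radicand `t⁴ − t³/a + t²` is positive, so
`β(t) = (t⁴ − t³/a + t²)^{−1/6} > 0` is well defined, and the point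
`(t·β, β, 1/(t·β²))` lies on `r₃ = Σ ∩ Λ₃`, i.e. it satisfies `x₁x₂x₃ = 1` and
`λ_a(x₃; x₁, x₂) = 0`. -/
theorem r3_parametrization (a : ℝ) (ha₀ : 0 < a) (ha : a < 1 / 2)
    (t : ℝ) (ht₀ : 0 < t) (hta : t ≤ a) :
    0 < t ^ 4 - t ^ 3 / a + t ^ 2 ∧
    ∀ β : ℝ, β = (t ^ 4 - t ^ 3 / a + t ^ 2) ^ (-(1 : ℝ) / 6) →
      0 < β ∧
      (t * β) * β * (1 / (t * β ^ 2)) = 1 ∧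
      lam a (1 / (t * β ^ 2)) (t * β) β = 0 := by
  have hD : 0 < t ^ 4 - t ^ 3 / a + t ^ 2 := by
    have hquot : t ^ 3 / a ≤ t ^ 2 := by
      rw [div_le_iff₀ ha₀, pow_succ]
      gcongr
    linarith [pow_pos ht₀ 4]
  refine ⟨hD, ?_⟩
  rintro β hβ
  have hβ₀ : 0 < β := hβ ▸ Real.rpow_pos_of_pos hD _
  have hβ6 : β ^ 6 * (t ^ 4 - t ^ 3 / a + t ^ 2) = 1 := by
    have hinv : β ^ 6 = (t ^ 4 - t ^ 3 / a + t ^ 2)⁻¹ := by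
      rw [hβ, ← Real.rpow_natCast, ← Real.rpow_mul hD.le, ← Real.rpow_neg_one]
      norm_num
    rw [hinv, inv_mul_cancel₀ hD.ne']
  refine ⟨hβ₀, by field_simp, ?_⟩
  have hfactor : lam a (1 / (t * β ^ 2)) (t * β) β =
      a * (1 - β ^ 6 * (t ^ 4 - t ^ 3 / a + t ^ 2)) / (t ^ 2 * β ^ 4) := by
    unfold lam
    field_simp
    ring
  rw [hfactor, hβ6, sub_self, mul_zero, zero_div]
end

section
/- Let a ∈ (0, 1/2) and m := (1 − √(1 − 4a²))/(2a). Then the set {(x₁, x₂, x₃) ∈ (0, ∞)³ : x₁x₂x₃ = 1, λ_a(x₃; x₁, x₂) = 0, and x₂ < m·x₁}, i.e. the component of the curve r₃ = Σ ∩ Λ₃ lying over the domain 0 < x₂ < m·x₁, is a connected subset of ℝ³. -/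
/-- The polynomial `1 + t² − t/a` is positive to the left of its smaller root. -/
lemma one_add_sq_sub_div_pos {a t : ℝ} (ha₀ : 0 < a)
    (ht : t < (1 - Real.sqrt (1 - 4 * a ^ 2)) / (2 * a)) (ha : a < 1 / 2) :
    0 < 1 + t ^ 2 - t / a := by
  have hd : 0 ≤ 1 - 4 * a ^ 2 := by nlinarith
  have hsq := Real.sq_sqrt hd
  have hs := Real.sqrt_nonneg (1 - 4 * a ^ 2)
  set r := Real.sqrt (1 - 4 * a ^ 2)
  rw [lt_div_iff₀ (by positivity)] at ht
  have hprod : 0 < (1 - r - t * (2 * a)) * (1 + r - t * (2 * a)) :=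
    mul_pos (by linarith) (by linarith)
  have hfac : 1 + t ^ 2 - t / a =
      (1 - r - t * (2 * a)) * (1 + r - t * (2 * a)) / (4 * a ^ 2) := by
    field_simp
    linear_combination hsq
  rw [hfac]
  positivity

/-- The point of the surface `x₁x₂x₃ = 1` on the ray through `(1, t, q)`. -/
noncomputable def unitVolumePoint (t q : ℝ) : ℝ × ℝ × ℝ :=
  ((t * q) ^ (-(1 / 3) : ℝ), t * (t * q) ^ (-(1 / 3) : ℝ), q * (t * q) ^ (-(1 / 3) : ℝ))

lemma rpow_neg_third_pow_three {u : ℝ} (hu : 0 < u) : (u ^ (-(1 / 3) : ℝ)) ^ 3 = u⁻¹ := by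
  rw [← Real.rpow_natCast, ← Real.rpow_mul hu.le, ← Real.rpow_neg_one]
  norm_num

/-- A positive `s` with `s³u = 1` is `u^(-1/3)`. -/
lemma eq_rpow_neg_third {s u : ℝ} (hs : 0 < s) (hu : 0 < u) (h : s ^ 3 * u = 1) :
    u ^ (-(1 / 3) : ℝ) = s := by
  refine (pow_left_inj₀ (Real.rpow_nonneg hu.le _) hs.le three_ne_zero).1 ?_
  rw [rpow_neg_third_pow_three hu]
  exact (eq_inv_of_mul_eq_one_left h).symm

/-- For `a ∈ (0, 1/2)` and `m = (1 − √(1 − 4a²))/(2a)`, the component of the curve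
`r₃ = Σ ∩ Λ₃` lying over the domain `0 < x₂ < m·x₁`, i.e. the set
`{(x₁, x₂, x₃) ∈ (0, ∞)³ : x₁x₂x₃ = 1, λ_a(x₃; x₁, x₂) = 0, x₂ < m·x₁}`,
is a connected subset of `ℝ³`. -/
theorem r3_component_connected (a : ℝ) (ha₀ : 0 < a) (ha : a < 1 / 2) :
    IsConnected {p : ℝ × ℝ × ℝ |
      0 < p.1 ∧ 0 < p.2.1 ∧ 0 < p.2.2 ∧
      p.1 * p.2.1 * p.2.2 = 1 ∧
      lam a p.2.2 p.1 p.2.1 = 0 ∧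
      p.2.1 < (1 - Real.sqrt (1 - 4 * a ^ 2)) / (2 * a) * p.1} := by
  have hm : 0 < (1 - Real.sqrt (1 - 4 * a ^ 2)) / (2 * a) := by
    have : Real.sqrt (1 - 4 * a ^ 2) < 1 := by
      rw [Real.sqrt_lt' one_pos]
      nlinarith [pow_pos ha₀ 2]
    exact div_pos (by linarith) (by positivity)
  have hpos : ∀ t < (1 - Real.sqrt (1 - 4 * a ^ 2)) / (2 * a), 0 < 1 + t ^ 2 - t / a :=
    fun t ht => one_add_sq_sub_div_pos ha₀ ht ha
  generalize (1 - Real.sqrt (1 - 4 * a ^ 2)) / (2 * a) = m at hm hpos ⊢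
  have hcont : ContinuousOn (fun t => unitVolumePoint t (Real.sqrt (1 + t ^ 2 - t / a)))
      (Set.Ioo 0 m) := by
    have hs : ContinuousOn
        (fun t : ℝ => (t * Real.sqrt (1 + t ^ 2 - t / a)) ^ (-(1 / 3) : ℝ)) (Set.Ioo 0 m) :=
      ContinuousOn.rpow_const (by fun_prop) fun t ht =>
        Or.inl (mul_pos ht.1 (Real.sqrt_pos.2 (hpos t ht.2))).ne'
    unfold unitVolumePoint
    fun_prop
  convert (isConnected_Ioo hm).image _ hcont using 1
  ext ⟨x, y, z⟩
  simp only [Set.mem_ofPred_eq, Set.mem_image, Set.mem_Ioo, unitVolumePoint, Prod.mk.injEq, lam]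
  constructor
  · rintro ⟨hx, hy, hz, hxyz, hlam, hlt⟩
    have hq : Real.sqrt (1 + (y / x) ^ 2 - y / x / a) = z / x := by
      rw [Real.sqrt_eq_iff_mul_self_eq_of_pos (by positivity)]
      field_simp
      linear_combination hlam
    have hscale : (y / x * (z / x)) ^ (-(1 / 3) : ℝ) = x :=
      eq_rpow_neg_third hx (by positivity) (by field_simp; linear_combination hxyz)
    refine ⟨y / x, ⟨by positivity, (div_lt_iff₀ hx).2 hlt⟩, ?_⟩
    rw [hq, hscale]
    exact ⟨rfl, div_mul_cancel₀ y hx.ne', div_mul_cancel₀ z hx.ne'⟩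
  · rintro ⟨t, ⟨ht, htm⟩, rfl, rfl, rfl⟩
    have hqsq := Real.sq_sqrt (hpos t htm).le
    have hq := Real.sqrt_pos.2 (hpos t htm)
    set q := Real.sqrt (1 + t ^ 2 - t / a)
    have hs : 0 < (t * q) ^ (-(1 / 3) : ℝ) := by positivity
    have hcube := rpow_neg_third_pow_three (mul_pos ht hq)
    set s := (t * q) ^ (-(1 / 3) : ℝ)
    refine ⟨hs, by positivity, by positivity, ?_, ?_, by gcongr⟩
    · calc s * (t * s) * (q * s) = s ^ 3 * (t * q) := by ring
        _ = 1 := by rw [hcube]; field_simp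
    · have hqa : a * q ^ 2 = a + a * t ^ 2 - t := by rw [hqsq]; field_simp
      linear_combination s ^ 2 * hqa
end

section
/- Let a ∈ (0, 1/2) and x₁, x₂, x₃ > 0 with x₁ ≠ x₂. Then the gradient of V(x₁, x₂, x₃) = x₁x₂x₃, namely (x₂x₃, x₁x₃, x₁x₂), and the gradient of λ₃ = λ_a(x₃; x₁, x₂), namely (x₂ − 2a·x₁, x₁ − 2a·x₂, 2a·x₃), are linearly independent vectors in ℝ³. In particular the surfaces Σ and Λ₃ intersect transversally, so each component of r₃ = Σ ∩ Λ₃ is a regular curve. -/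
/-- For `a ∈ (0, 1/2)` and positive `x₁, x₂, x₃` with `x₁ ≠ x₂`, the gradient
`(x₂x₃, x₁x₃, x₁x₂)` of `V = x₁x₂x₃` and the gradient
`(x₂ − 2a·x₁, x₁ − 2a·x₂, 2a·x₃)` of `λ₃ = x₁x₂ + a(x₃² − x₁² − x₂²)` are linearly
independent vectors in `ℝ³`; hence `Σ` and `Λ₃` intersect transversally, so each
component of `r₃ = Σ ∩ Λ₃` is a regular curve. -/
theorem gradients_V_lambda3_linearIndependent (a : ℝ) (ha₀ : 0 < a) (ha : a < 1 / 2)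
    (x₁ x₂ x₃ : ℝ) (h₁ : 0 < x₁) (h₂ : 0 < x₂) (h₃ : 0 < x₃) (h : x₁ ≠ x₂) :
    LinearIndependent ℝ
      ![(![x₂ * x₃, x₁ * x₃, x₁ * x₂] : Fin 3 → ℝ),
        ![x₂ - 2 * a * x₁, x₁ - 2 * a * x₂, 2 * a * x₃]] := by
  rw [LinearIndependent.pair_iff]
  intro s t hst
  have e₁ : s * (x₂ * x₃) + t * (x₂ - 2 * a * x₁) = 0 := by simpa using congrFun hst 0
  have e₂ : s * (x₁ * x₃) + t * (x₁ - 2 * a * x₂) = 0 := by simpa using congrFun hst 1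
  have hsum : x₁ + x₂ ≠ 0 := by positivity
  have hcoeff : 2 * a * ((x₁ - x₂) * (x₁ + x₂)) ≠ 0 :=
    mul_ne_zero (by positivity) (mul_ne_zero (sub_ne_zero.mpr h) hsum)
  have ht : t = 0 := (mul_eq_zero.mp (by linear_combination x₂ * e₂ - x₁ * e₁ :
    t * (2 * a * ((x₁ - x₂) * (x₁ + x₂))) = 0)).resolve_right hcoeff
  subst ht
  refine ⟨(mul_eq_zero.mp (by linear_combination e₁ : s * (x₂ * x₃) = 0)).resolve_right ?_, rfl⟩
  positivity
end

section
/- Let a ∈ (0, 1/2) and let x₁, x₂, x₃ > 0 satisfy γ_i = γ(x_i; x_j, x_k) > 0 for all {i, j, k} = {1, 2, 3}. Then λ_i = λ_a(x_i; x_j, x_k) > 0 for all {i, j, k} = {1, 2, 3}; that is, S ⊆ R: positivity of sectional curvature of an invariant metric implies positivity of its Ricci curvature, for every a ∈ (0, 1/2). -/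
/-- Positivity of `γ(x; y, z)` forces the strict triangle inequality `x < y + z`. -/
theorem lt_add_of_gamma_pos {x y z : ℝ} (hy : 0 < y) (hz : 0 < z)
    (h : 0 < gamma x y z) : x < y + z := by
  unfold gamma at h
  by_contra! hx
  have hfactor : 0 ≤ (x - (y + z)) * (y + z + 3 * x) :=
    mul_nonneg (by linarith) (by linarith)
  nlinarith [mul_pos hy hz]

/-- `λ_a(x; y, z)` is positive for `0 < a < 1/2` whenever `|y - z| < x`. -/
theorem lam_pos_of_lt_add {a x y z : ℝ} (ha₀ : 0 < a) (ha : a < 1 / 2)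
    (hy : 0 < y) (hz : 0 < z) (hyx : y < x + z) (hzx : z < x + y) :
    0 < lam a x y z := by
  have hfactor : 0 < a * ((x + z - y) * (x + y - z)) :=
    mul_pos ha₀ (mul_pos (by linarith) (by linarith))
  have hrest : 0 < (1 - 2 * a) * (y * z) := mul_pos (by linarith) (mul_pos hy hz)
  unfold lam
  linarith

/-- `S ⊆ R`: for every `a ∈ (0, 1/2)`, if `(x₁, x₂, x₃) ∈ (0, ∞)³` satisfies
`γ_i > 0` for all `i` (positive sectional curvature), then `λ_i > 0` for all `i`
(positive Ricci curvature). -/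
theorem S_subset_R (a : ℝ) (ha₀ : 0 < a) (ha : a < 1 / 2)
    (x₁ x₂ x₃ : ℝ) (h₁ : 0 < x₁) (h₂ : 0 < x₂) (h₃ : 0 < x₃)
    (hγ₁ : 0 < gamma x₁ x₂ x₃) (hγ₂ : 0 < gamma x₂ x₁ x₃)
    (hγ₃ : 0 < gamma x₃ x₁ x₂) :
    0 < lam a x₁ x₂ x₃ ∧ 0 < lam a x₂ x₁ x₃ ∧ 0 < lam a x₃ x₁ x₂ := by
  have t₁ := lt_add_of_gamma_pos h₂ h₃ hγ₁
  have t₂ := lt_add_of_gamma_pos h₁ h₃ hγ₂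
  have t₃ := lt_add_of_gamma_pos h₁ h₂ hγ₃
  refine ⟨lam_pos_of_lt_add ha₀ ha h₂ h₃ ?_ ?_, lam_pos_of_lt_add ha₀ ha h₁ h₃ ?_ ?_,
    lam_pos_of_lt_add ha₀ ha h₁ h₂ ?_ ?_⟩ <;> linarith
end
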